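/- arXiv:2502.21149 — 2 statements merged into one kernel-verified Lean document; each statement's English description precedes it below -/
import Mathlib

section
/- Let (X,T) be a nonautonomous dynamical system and ε > 0. For every family F of open Bowen balls of radius ε (that is, sets of the form B_n^T(x,ε) with x ∈ X_0 and n ≥ 1), there exists a subfamily G ⊂ F consisting of pairwise disjoint Bowen balls such that the union of all balls in F is contained in the union over B_n^T(x,ε) ∈ G of the enlarged balls B_n^T(x,3ε). -/
open Filter MeasureTheory Set
open scoped ENNReal Topology

namespace NDS

variable {X : ℕ → Type*}

/-- Iterates `T^j : X 0 → X j` of a nonautonomous dynamical system `T`. -/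
def iter (T : ∀ k, X k → X (k + 1)) : ∀ j, X 0 → X j
  | 0 => fun x => x
  | j + 1 => fun x => T j (iter T j x)

/-- The Birkhoff-type sum `S_n^T f (x) = ∑_{j<n} f_j (T^j x)`. -/
def birk (T : ∀ k, X k → X (k + 1)) (f : ∀ k, X k → ℝ) (n : ℕ) (x : X 0) : ℝ :=
  ∑ j ∈ Finset.range n, f j (iter T j x)

/-- The uniform norm `‖f‖ = sup_k sup_x |f_k x|` of a sequence of potentials. -/
noncomputable def fnorm (f : ∀ k, X k → ℝ) : ℝ :=
  ⨆ k : ℕ, ⨆ x : X k, |f k x|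

/-- `log : ℝ≥0∞ → EReal` with the conventions `log 0 = -∞`, `log ∞ = ∞`. -/
noncomputable def elog (x : ℝ≥0∞) : EReal :=
  if x = 0 then ⊥ else if x = ⊤ then ⊤ else ((Real.log x.toReal : ℝ) : EReal)

/-- The nonnegative part of an extended real, as an element of `ℝ≥0∞`. -/
noncomputable def toENN (x : EReal) : ℝ≥0∞ :=
  if x = ⊤ then ⊤ else ENNReal.ofReal x.toReal

/-- The canonical map `ℝ≥0∞ → EReal`. -/
noncomputable def ofENN (x : ℝ≥0∞) : EReal :=
  if x = ⊤ then ⊤ else ((x.toReal : ℝ) : EReal)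

/-- The integral of an extended-real-valued function: the difference of the lower
integrals of its positive and negative parts. -/
noncomputable def eInt {α : Type*} [MeasurableSpace α] (μ : Measure α) (g : α → EReal) : EReal :=
  ofENN (∫⁻ x, toENN (g x) ∂μ) - ofENN (∫⁻ x, toENN (-g x) ∂μ)

section Metric

variable [∀ k, MetricSpace (X k)]

/-- The open Bowen ball `B_n^T(x,ε)`. -/
def bowenBall (T : ∀ k, X k → X (k + 1)) (n : ℕ) (ε : ℝ) (x : X 0) : Set (X 0) :=
  {y | ∀ j < n, dist (iter T j x) (iter T j y) < ε}

/-- The closed Bowen ball `B̄_n^T(x,ε)`. -/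
def bowenClosedBall (T : ∀ k, X k → X (k + 1)) (n : ℕ) (ε : ℝ) (x : X 0) : Set (X 0) :=
  {y | ∀ j < n, dist (iter T j x) (iter T j y) ≤ ε}

/-- Equicontinuity of a sequence of potentials `f = (f_k)`. -/
def EquicontPotential (f : ∀ k, X k → ℝ) : Prop :=
  ∀ ε : ℝ, 0 < ε → ∃ δ : ℝ, 0 < δ ∧ ∀ k, ∀ x y : X k, dist x y < δ → |f k x - f k y| < ε

/-- The supremum of the Birkhoff sum `S_n^T f` over a subset `A` of `X 0`. -/
noncomputable def supBirk (T : ∀ k, X k → X (k + 1)) (f : ∀ k, X k → ℝ) (n : ℕ)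
    (A : Set (X 0)) : ℝ :=
  ⨆ y : A, birk T f n (y : X 0)

/-- Measure-theoretic lower local pressure `P̲_μ(T,f,x)`. -/
noncomputable def localLowerPres [MeasurableSpace (X 0)] (μ : Measure (X 0))
    (T : ∀ k, X k → X (k + 1)) (f : ∀ k, X k → ℝ) (x : X 0) : EReal :=
  ⨆ (ε : ℝ) (_ : 0 < ε),
    liminf (fun n : ℕ =>
      (((n : ℝ)⁻¹ : ℝ) : EReal) *
        (-(elog (μ (bowenBall T n ε x))) + ((birk T f n x : ℝ) : EReal))) atTop

/-- Measure-theoretic upper local pressure `P̄_μ(T,f,x)`. -/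
noncomputable def localUpperPres [MeasurableSpace (X 0)] (μ : Measure (X 0))
    (T : ∀ k, X k → X (k + 1)) (f : ∀ k, X k → ℝ) (x : X 0) : EReal :=
  ⨆ (ε : ℝ) (_ : 0 < ε),
    limsup (fun n : ℕ =>
      (((n : ℝ)⁻¹ : ℝ) : EReal) *
        (-(elog (μ (bowenBall T n ε x))) + ((birk T f n x : ℝ) : EReal))) atTop

/-- Measure-theoretic lower local entropy `h̲_μ(T,x)`. -/
noncomputable def localLowerEnt [MeasurableSpace (X 0)] (μ : Measure (X 0))
    (T : ∀ k, X k → X (k + 1)) (x : X 0) : EReal :=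
  ⨆ (ε : ℝ) (_ : 0 < ε),
    liminf (fun n : ℕ =>
      (((n : ℝ)⁻¹ : ℝ) : EReal) * (-(elog (μ (bowenBall T n ε x))))) atTop

/-- Measure-theoretic upper local entropy `h̄_μ(T,x)`. -/
noncomputable def localUpperEnt [MeasurableSpace (X 0)] (μ : Measure (X 0))
    (T : ∀ k, X k → X (k + 1)) (x : X 0) : EReal :=
  ⨆ (ε : ℝ) (_ : 0 < ε),
    limsup (fun n : ℕ =>
      (((n : ℝ)⁻¹ : ℝ) : EReal) * (-(elog (μ (bowenBall T n ε x))))) atTop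

/-- Measure-theoretic lower pressure `P̲_μ(T,f) = ∫ P̲_μ(T,f,x) dμ(x)`. -/
noncomputable def lowerPres [MeasurableSpace (X 0)] (μ : Measure (X 0))
    (T : ∀ k, X k → X (k + 1)) (f : ∀ k, X k → ℝ) : EReal :=
  eInt μ (fun x => localLowerPres μ T f x)

/-- Measure-theoretic upper pressure `P̄_μ(T,f) = ∫ P̄_μ(T,f,x) dμ(x)`. -/
noncomputable def upperPres [MeasurableSpace (X 0)] (μ : Measure (X 0))
    (T : ∀ k, X k → X (k + 1)) (f : ∀ k, X k → ℝ) : EReal :=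
  eInt μ (fun x => localUpperPres μ T f x)

/-- Measure-theoretic lower entropy `h̲_μ(T) = ∫ h̲_μ(T,x) dμ(x)`. -/
noncomputable def lowerEnt [MeasurableSpace (X 0)] (μ : Measure (X 0))
    (T : ∀ k, X k → X (k + 1)) : EReal :=
  eInt μ (fun x => localLowerEnt μ T x)

/-- Measure-theoretic upper entropy `h̄_μ(T) = ∫ h̄_μ(T,x) dμ(x)`. -/
noncomputable def upperEnt [MeasurableSpace (X 0)] (μ : Measure (X 0))
    (T : ∀ k, X k → X (k + 1)) : EReal :=
  eInt μ (fun x => localUpperEnt μ T x)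

/-- The Bowen premeasure `M^s_{N,ε}(T,f,Z)`: the infimum of
`∑ exp(-n_i s + S_{n_i}^T f(x_i))` over all countable `(N,ε)`-covers of `Z` by open
Bowen balls `B_{n_i}^T(x_i,ε)` with `n_i ≥ N`. -/
noncomputable def bowenPre (T : ∀ k, X k → X (k + 1)) (f : ∀ k, X k → ℝ)
    (s : ℝ) (N : ℕ) (ε : ℝ) (Z : Set (X 0)) : ℝ≥0∞ :=
  ⨅ (D : Set (X 0 × ℕ)) (_ : D.Countable) (_ : ∀ p ∈ D, N ≤ p.2)
      (_ : Z ⊆ ⋃ p ∈ D, bowenBall T p.2 ε p.1),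
    ∑' p : D, ENNReal.ofReal (Real.exp (-(p.1.2 : ℝ) * s + birk T f p.1.2 p.1.1))

/-- `M^s_ε(T,f,Z) = lim_{N→∞} M^s_{N,ε}(T,f,Z)` (an increasing limit). -/
noncomputable def bowenPreLim (T : ∀ k, X k → X (k + 1)) (f : ∀ k, X k → ℝ)
    (s : ℝ) (ε : ℝ) (Z : Set (X 0)) : ℝ≥0∞ :=
  ⨆ N : ℕ, bowenPre T f s N ε Z

/-- The critical value `P^B(T,f,Z,ε) = inf {s : M^s_ε(T,f,Z) = 0}`. -/
noncomputable def bowenCrit (T : ∀ k, X k → X (k + 1)) (f : ∀ k, X k → ℝ)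
    (ε : ℝ) (Z : Set (X 0)) : EReal :=
  ⨅ (s : ℝ) (_ : bowenPreLim T f s ε Z = 0), (s : EReal)

/-- The Bowen (Pesin–Pitskel') topological pressure
`P^B(T,f,Z) = lim_{ε→0} P^B(T,f,Z,ε)` (an increasing limit as `ε ↓ 0`). -/
noncomputable def bowenP (T : ∀ k, X k → X (k + 1)) (f : ∀ k, X k → ℝ)
    (Z : Set (X 0)) : EReal :=
  ⨆ (ε : ℝ) (_ : 0 < ε), bowenCrit T f ε Z

/-- The Bowen topological entropy `h^B(T,Z) = P^B(T,0,Z)`. -/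
noncomputable def bowenEnt (T : ∀ k, X k → X (k + 1)) (Z : Set (X 0)) : EReal :=
  bowenP T (fun k => fun _ : X k => (0 : ℝ)) Z

/-- The premeasure `N^s_{N,ε}(T,f,Z)` using suprema of Birkhoff sums over the balls. -/
noncomputable def nBowenPre (T : ∀ k, X k → X (k + 1)) (f : ∀ k, X k → ℝ)
    (s : ℝ) (N : ℕ) (ε : ℝ) (Z : Set (X 0)) : ℝ≥0∞ :=
  ⨅ (D : Set (X 0 × ℕ)) (_ : D.Countable) (_ : ∀ p ∈ D, N ≤ p.2)
      (_ : Z ⊆ ⋃ p ∈ D, bowenBall T p.2 ε p.1),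
    ∑' p : D, ENNReal.ofReal
      (Real.exp (-(p.1.2 : ℝ) * s + supBirk T f p.1.2 (bowenBall T p.1.2 ε p.1.1)))

/-- `N^s_ε(T,f,Z) = lim_{N→∞} N^s_{N,ε}(T,f,Z)`. -/
noncomputable def nBowenPreLim (T : ∀ k, X k → X (k + 1)) (f : ∀ k, X k → ℝ)
    (s : ℝ) (ε : ℝ) (Z : Set (X 0)) : ℝ≥0∞ :=
  ⨆ N : ℕ, nBowenPre T f s N ε Z

/-- The critical value `Q^B(T,f,Z,ε) = inf {s : N^s_ε(T,f,Z) = 0}`. -/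
noncomputable def nBowenCrit (T : ∀ k, X k → X (k + 1)) (f : ∀ k, X k → ℝ)
    (ε : ℝ) (Z : Set (X 0)) : EReal :=
  ⨅ (s : ℝ) (_ : nBowenPreLim T f s ε Z = 0), (s : EReal)

/-- The weighted Bowen premeasure `W^s_{N,ε}(T,f,g)`: the infimum of
`∑ c_i exp(-n_i s + sup_{B_{n_i}^T(x_i,ε)} S_{n_i}^T f)` over all countable families
`{(B_{n_i}^T(x_i,ε), c_i)}` with `0 < c_i`, `n_i ≥ N` and `∑ c_i χ_{B_i} ≥ g`. -/
noncomputable def wBowenPre (T : ∀ k, X k → X (k + 1)) (f : ∀ k, X k → ℝ)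
    (s : ℝ) (N : ℕ) (ε : ℝ) (g : X 0 → ℝ) : ℝ≥0∞ :=
  ⨅ (D : Set ((X 0 × ℕ) × ℝ)) (_ : D.Countable)
      (_ : ∀ p ∈ D, N ≤ p.1.2 ∧ 0 < p.2)
      (_ : ∀ x : X 0, ENNReal.ofReal (g x) ≤
        ∑' p : D, (bowenBall T p.1.1.2 ε p.1.1.1).indicator
          (fun _ => ENNReal.ofReal p.1.2) x),
    ∑' p : D, ENNReal.ofReal p.1.2 *
      ENNReal.ofReal
        (Real.exp (-(p.1.1.2 : ℝ) * s + supBirk T f p.1.1.2 (bowenBall T p.1.1.2 ε p.1.1.1)))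

/-- `D` is a countable `(N,ε)`-packing of `Z`: the closed Bowen balls
`B̄_{n}^T(x,ε)`, `(x,n) ∈ D`, are pairwise disjoint with centers in `Z` and orders `≥ N`. -/
def IsPacking (T : ∀ k, X k → X (k + 1)) (N : ℕ) (ε : ℝ) (Z : Set (X 0))
    (D : Set (X 0 × ℕ)) : Prop :=
  D.Countable ∧ (∀ p ∈ D, p.1 ∈ Z ∧ N ≤ p.2) ∧
    ∀ p ∈ D, ∀ q ∈ D, p ≠ q →
      Disjoint (bowenClosedBall T p.2 ε p.1) (bowenClosedBall T q.2 ε q.1)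

/-- The packing premeasure `P^s_{N,ε}(T,f,Z)`: the supremum of
`∑ exp(-n_i s + S_{n_i}^T f(x_i))` over all countable `(N,ε)`-packings of `Z`. -/
noncomputable def packPre (T : ∀ k, X k → X (k + 1)) (f : ∀ k, X k → ℝ)
    (s : ℝ) (N : ℕ) (ε : ℝ) (Z : Set (X 0)) : ℝ≥0∞ :=
  ⨆ (D : Set (X 0 × ℕ)) (_ : IsPacking T N ε Z D),
    ∑' p : D, ENNReal.ofReal (Real.exp (-(p.1.2 : ℝ) * s + birk T f p.1.2 p.1.1))

/-- `P^s_{∞,ε}(T,f,Z) = lim_{N→∞} P^s_{N,ε}(T,f,Z)` (a decreasing limit). -/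
noncomputable def packPreInf (T : ∀ k, X k → X (k + 1)) (f : ∀ k, X k → ℝ)
    (s : ℝ) (ε : ℝ) (Z : Set (X 0)) : ℝ≥0∞ :=
  ⨅ N : ℕ, packPre T f s N ε Z

/-- The packing measure-like quantity
`P^s_ε(T,f,Z) = inf { ∑_i P^s_{∞,ε}(T,f,Z_i) : Z ⊆ ⋃_i Z_i }`. -/
noncomputable def packMeasure (T : ∀ k, X k → X (k + 1)) (f : ∀ k, X k → ℝ)
    (s : ℝ) (ε : ℝ) (Z : Set (X 0)) : ℝ≥0∞ :=
  ⨅ (Zs : ℕ → Set (X 0)) (_ : Z ⊆ ⋃ i, Zs i), ∑' i, packPreInf T f s ε (Zs i)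

/-- The critical value `P^P(T,f,Z,ε) = inf {s : P^s_ε(T,f,Z) = 0}`. -/
noncomputable def packCrit (T : ∀ k, X k → X (k + 1)) (f : ∀ k, X k → ℝ)
    (ε : ℝ) (Z : Set (X 0)) : EReal :=
  ⨅ (s : ℝ) (_ : packMeasure T f s ε Z = 0), (s : EReal)

/-- The packing topological pressure `P^P(T,f,Z) = lim_{ε→0} P^P(T,f,Z,ε)`. -/
noncomputable def packP (T : ∀ k, X k → X (k + 1)) (f : ∀ k, X k → ℝ)
    (Z : Set (X 0)) : EReal :=
  ⨆ (ε : ℝ) (_ : 0 < ε), packCrit T f ε Z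

/-- The packing topological entropy `h^P(T,Z) = P^P(T,0,Z)`. -/
noncomputable def packEnt (T : ∀ k, X k → X (k + 1)) (Z : Set (X 0)) : EReal :=
  packP T (fun k => fun _ : X k => (0 : ℝ)) Z

/-- The packing premeasure `Q^s_{N,ε}(T,f,Z)` using suprema of Birkhoff sums over the balls. -/
noncomputable def qPackPre (T : ∀ k, X k → X (k + 1)) (f : ∀ k, X k → ℝ)
    (s : ℝ) (N : ℕ) (ε : ℝ) (Z : Set (X 0)) : ℝ≥0∞ :=
  ⨆ (D : Set (X 0 × ℕ)) (_ : IsPacking T N ε Z D),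
    ∑' p : D, ENNReal.ofReal
      (Real.exp (-(p.1.2 : ℝ) * s + supBirk T f p.1.2 (bowenClosedBall T p.1.2 ε p.1.1)))

/-- `Q^s_{∞,ε}(T,f,Z) = lim_{N→∞} Q^s_{N,ε}(T,f,Z)`. -/
noncomputable def qPackPreInf (T : ∀ k, X k → X (k + 1)) (f : ∀ k, X k → ℝ)
    (s : ℝ) (ε : ℝ) (Z : Set (X 0)) : ℝ≥0∞ :=
  ⨅ N : ℕ, qPackPre T f s N ε Z

/-- `Q^s_ε(T,f,Z) = inf { ∑_i Q^s_{∞,ε}(T,f,Z_i) : Z ⊆ ⋃_i Z_i }`. -/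
noncomputable def qPackMeasure (T : ∀ k, X k → X (k + 1)) (f : ∀ k, X k → ℝ)
    (s : ℝ) (ε : ℝ) (Z : Set (X 0)) : ℝ≥0∞ :=
  ⨅ (Zs : ℕ → Set (X 0)) (_ : Z ⊆ ⋃ i, Zs i), ∑' i, qPackPreInf T f s ε (Zs i)

/-- The critical value `Q^P(T,f,Z,ε) = inf {s : Q^s_ε(T,f,Z) = 0}`. -/
noncomputable def qPackCrit (T : ∀ k, X k → X (k + 1)) (f : ∀ k, X k → ℝ)
    (ε : ℝ) (Z : Set (X 0)) : EReal :=
  ⨅ (s : ℝ) (_ : qPackMeasure T f s ε Z = 0), (s : EReal)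

end Metric

/-- The distance function of an explicitly given metric space structure. -/
def mdist {α : Type*} (m : MetricSpace α) (x y : α) : ℝ :=
  @dist α m.toPseudoMetricSpace.toDist x y

section Covering

variable [∀ k, MetricSpace (X k)]

theorem mem_bowenBall_self (T : ∀ k, X k → X (k + 1)) (n : ℕ) {ε : ℝ} (hε : 0 < ε) (x : X 0) :
    x ∈ bowenBall T n ε x := fun j _ => by
  rwa [dist_self]

/-- A Bowen ball meeting a Bowen ball of no larger order is contained in the enlargement of the
latter by a factor of three. -/
theorem bowenBall_subset_of_inter_nonempty (T : ∀ k, X k → X (k + 1)) {m n : ℕ} (hnm : n ≤ m)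
    {ε : ℝ} {x y : X 0} (h : (bowenBall T m ε y ∩ bowenBall T n ε x).Nonempty) :
    bowenBall T m ε y ⊆ bowenBall T n (3 * ε) x := by
  obtain ⟨z, hzy, hzx⟩ := h
  intro w hw j hj
  have hwj := hw j (hj.trans_le hnm)
  have hyj := hzy j (hj.trans_le hnm)
  have hxj := hzx j hj
  have htri := dist_triangle4 (iter T j x) (iter T j z) (iter T j y) (iter T j w)
  rw [dist_comm (iter T j z) (iter T j y)] at htri
  linarith

end Covering

end NDS

open NDS in
/-- A `3ε`-covering lemma for Bowen balls.
For every family `F` of open Bowen balls of radius `ε` (given by pairs `(x,n)` with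
`n ≥ 1`), there is a subfamily `G ⊆ F` whose balls are pairwise disjoint and such that
the union of all balls of `F` is contained in the union of the enlarged balls
`B_n^T(x,3ε)`, `(x,n) ∈ G`. -/
theorem stmt7 {X : ℕ → Type*} [∀ k, MetricSpace (X k)] [∀ k, CompactSpace (X k)]
    (T : ∀ k, X k → X (k + 1)) (hT : ∀ k, Continuous (T k))
    (ε : ℝ) (hε : 0 < ε)
    (F : Set (X 0 × ℕ)) (hF : ∀ p ∈ F, 1 ≤ p.2) :
    ∃ G ⊆ F,
      ((fun p : X 0 × ℕ => bowenBall T p.2 ε p.1) '' G).PairwiseDisjoint id ∧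
      (⋃ p ∈ F, bowenBall T p.2 ε p.1) ⊆ ⋃ p ∈ G, bowenBall T p.2 (3 * ε) p.1 := by
  obtain ⟨G, hGF, hdisj, hcov⟩ := Vitali.exists_disjoint_subfamily_covering_enlargement
    (fun p : X 0 × ℕ => bowenBall T p.2 ε p.1) F (fun p => (1 / 2 : ℝ) ^ p.2) (3 / 2)
    (by norm_num) (fun p _ => by positivity) 1
    (fun p _ => pow_le_one₀ (by norm_num) (by norm_num))
    (fun p _ => ⟨p.1, mem_bowenBall_self T p.2 hε p.1⟩)
  refine ⟨G, hGF, ?_, iUnion₂_subset fun p hp => ?_⟩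
  · rintro _ ⟨p, hp, rfl⟩ _ ⟨q, hq, rfl⟩ hpq
    exact hdisj hp hq (fun h => hpq (h ▸ rfl))
  · obtain ⟨q, hq, hinter, hsize⟩ := hcov p hp
    have hle : q.2 ≤ p.2 := by
      by_contra! hlt
      have hpow : (1 / 2 : ℝ) ^ q.2 ≤ (1 / 2) ^ (p.2 + 1) :=
        pow_le_pow_of_le_one (by norm_num) (by norm_num) hlt
      have hpos : (0 : ℝ) < (1 / 2) ^ p.2 := by positivity
      rw [pow_succ] at hpow
      linarith
    exact (bowenBall_subset_of_inter_nonempty T hle hinter).trans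
      (subset_biUnion_of_mem (u := fun p : X 0 × ℕ => bowenBall T p.2 (3 * ε) p.1) hq)
end

section
/- Let (X,T) be a nonautonomous dynamical system, Z ⊂ X_0, and f = (f_k) an equicontinuous sequence of continuous real-valued potentials. Then Q^P(T,f,Z,ε) converges as ε → 0 and P^P(T,f,Z) = lim_{ε→0} Q^P(T,f,Z,ε). -/
open Filter MeasureTheory Set
open scoped ENNReal Topology

namespace NDS

variable {X : ℕ → Type*} [∀ k, MetricSpace (X k)]

lemma mem_bowenClosedBall_self (T : ∀ k, X k → X (k + 1)) (n : ℕ) {ε : ℝ} (hε : 0 ≤ ε)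
    (x : X 0) : x ∈ bowenClosedBall T n ε x := fun j _ => by simpa using hε

lemma bowenClosedBall_mono (T : ∀ k, X k → X (k + 1)) (n : ℕ) {ε ε' : ℝ} (h : ε' ≤ ε)
    (x : X 0) : bowenClosedBall T n ε' x ⊆ bowenClosedBall T n ε x :=
  fun _ hy j hj => (hy j hj).trans h

lemma IsPacking.anti {T : ∀ k, X k → X (k + 1)} {N : ℕ} {ε ε' : ℝ} (h : ε' ≤ ε)
    {Z : Set (X 0)} {D : Set (X 0 × ℕ)} (hD : IsPacking T N ε Z D) : IsPacking T N ε' Z D :=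
  ⟨hD.1, hD.2.1, fun p hp q hq hpq => (hD.2.2 p hp q hq hpq).mono
    (bowenClosedBall_mono T _ h _) (bowenClosedBall_mono T _ h _)⟩

lemma packCrit_anti (T : ∀ k, X k → X (k + 1)) (f : ∀ k, X k → ℝ) {ε ε' : ℝ} (h : ε' ≤ ε)
    (Z : Set (X 0)) : packCrit T f ε Z ≤ packCrit T f ε' Z := by
  refine biInf_mono fun s hs => le_antisymm (le_trans ?_ (le_of_eq hs)) zero_le
  exact iInf₂_mono fun Zs _ => ENNReal.tsum_le_tsum fun i => iInf_mono fun N =>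
    iSup₂_le fun D hD => le_iSup₂_of_le D (hD.anti h) le_rfl

/-- If each `f k` varies by less than `η` at distances below `δ`, then Birkhoff sums of length `n`
vary by at most `n * η` on closed Bowen balls of radius `ε < δ`. -/
lemma birk_le_add (T : ∀ k, X k → X (k + 1)) (f : ∀ k, X k → ℝ) {ε δ η : ℝ}
    (hδ : ∀ k, ∀ x y : X k, dist x y < δ → |f k x - f k y| < η) (hε : ε < δ) (n : ℕ)
    {x y : X 0} (hy : y ∈ bowenClosedBall T n ε x) : birk T f n y ≤ birk T f n x + n * η := by
  have h : ∑ j ∈ Finset.range n, f j (iter T j y) ≤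
      ∑ j ∈ Finset.range n, (f j (iter T j x) + η) :=
    Finset.sum_le_sum fun j hj => by
      have := (abs_lt.1 (hδ j _ _ ((hy j (Finset.mem_range.1 hj)).trans_lt hε))).1
      linarith
  simpa [birk, Finset.sum_add_distrib] using h

lemma supBirk_le_add (T : ∀ k, X k → X (k + 1)) (f : ∀ k, X k → ℝ) {ε δ η : ℝ}
    (hδ : ∀ k, ∀ x y : X k, dist x y < δ → |f k x - f k y| < η) (hε₀ : 0 ≤ ε) (hε : ε < δ)
    (n : ℕ) (x : X 0) : supBirk T f n (bowenClosedBall T n ε x) ≤ birk T f n x + n * η :=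
  haveI : Nonempty (bowenClosedBall T n ε x) := ⟨⟨x, mem_bowenClosedBall_self T n hε₀ x⟩⟩
  ciSup_le fun y => birk_le_add T f hδ hε n y.2

lemma birk_le_supBirk (T : ∀ k, X k → X (k + 1)) (f : ∀ k, X k → ℝ) {ε δ η : ℝ}
    (hδ : ∀ k, ∀ x y : X k, dist x y < δ → |f k x - f k y| < η) (hε₀ : 0 ≤ ε) (hε : ε < δ)
    (n : ℕ) (x : X 0) : birk T f n x ≤ supBirk T f n (bowenClosedBall T n ε x) :=
  le_ciSup (f := fun y : bowenClosedBall T n ε x => birk T f n (y : X 0))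
    ⟨birk T f n x + n * η, by rintro _ ⟨y, rfl⟩; exact birk_le_add T f hδ hε n y.2⟩
    ⟨x, mem_bowenClosedBall_self T n hε₀ x⟩

lemma packCrit_le_qPackCrit (T : ∀ k, X k → X (k + 1)) (f : ∀ k, X k → ℝ) {ε δ η : ℝ}
    (hδ : ∀ k, ∀ x y : X k, dist x y < δ → |f k x - f k y| < η) (hε₀ : 0 ≤ ε) (hε : ε < δ)
    (Z : Set (X 0)) : packCrit T f ε Z ≤ qPackCrit T f ε Z := by
  refine biInf_mono fun s hs => le_antisymm (le_trans ?_ (le_of_eq hs)) zero_le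
  refine iInf₂_mono fun Zs _ => ENNReal.tsum_le_tsum fun i => iInf_mono fun N =>
    iSup₂_mono fun D _ => ENNReal.tsum_le_tsum fun p => ?_
  gcongr
  exact birk_le_supBirk T f hδ hε₀ hε _ _

lemma qPackMeasure_add_le (T : ∀ k, X k → X (k + 1)) (f : ∀ k, X k → ℝ) {ε δ η : ℝ}
    (hδ : ∀ k, ∀ x y : X k, dist x y < δ → |f k x - f k y| < η) (hε₀ : 0 ≤ ε) (hε : ε < δ)
    (s : ℝ) (Z : Set (X 0)) : qPackMeasure T f (s + η) ε Z ≤ packMeasure T f s ε Z := by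
  refine iInf₂_mono fun Zs _ => ENNReal.tsum_le_tsum fun i => iInf_mono fun N =>
    iSup₂_mono fun D _ => ENNReal.tsum_le_tsum fun p =>
      ENNReal.ofReal_le_ofReal (Real.exp_le_exp.2 ?_)
  linarith [supBirk_le_add T f hδ hε₀ hε p.1.2 p.1.1]

end NDS

open NDS in
/-- Equivalent definition of the packing pressure.
If `f` is equicontinuous then `Q^P(T,f,Z,ε)` converges as `ε → 0⁺` and its limit
is the packing pressure `P^P(T,f,Z)`. -/
theorem stmt11 {X : ℕ → Type*} [∀ k, MetricSpace (X k)] [∀ k, CompactSpace (X k)]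
    (T : ∀ k, X k → X (k + 1)) (hT : ∀ k, Continuous (T k))
    (f : ∀ k, X k → ℝ) (hf : ∀ k, Continuous (f k)) (hfe : EquicontPotential f)
    (Z : Set (X 0)) :
    Filter.Tendsto (fun ε : ℝ => qPackCrit T f ε Z) (nhdsWithin 0 (Set.Ioi 0))
      (nhds (packP T f Z)) := by
  refine tendsto_order.2 ⟨fun a ha => ?_, fun b hb => ?_⟩
  · obtain ⟨δ, hδ₀, hδ⟩ := hfe 1 one_pos
    obtain ⟨ε₀, hε₀⟩ := lt_iSup_iff.1 ha
    obtain ⟨hpos, hlt⟩ := lt_iSup_iff.1 hε₀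
    filter_upwards [Ioo_mem_nhdsGT (lt_min hpos hδ₀)] with ε hε
    have hε' := lt_min_iff.1 hε.2
    exact hlt.trans_le ((packCrit_anti T f hε'.1.le Z).trans
      (packCrit_le_qPackCrit T f hδ hε.1.le hε'.2 Z))
  · obtain ⟨d, hd, hdb⟩ := EReal.lt_iff_exists_real_btwn.1 hb
    obtain ⟨c, hc, hcd⟩ := EReal.lt_iff_exists_real_btwn.1 hd
    obtain ⟨δ, hδ₀, hδ⟩ := hfe (d - c) (sub_pos.2 (EReal.coe_lt_coe_iff.1 hcd))
    filter_upwards [Ioo_mem_nhdsGT hδ₀] with ε hε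
    have hεc : packCrit T f ε Z < c :=
      (le_iSup₂ (f := fun (ε : ℝ) (_ : 0 < ε) => packCrit T f ε Z) ε hε.1).trans_lt hc
    obtain ⟨s, hs⟩ := iInf_lt_iff.1 hεc
    obtain ⟨hs₀, hsc⟩ := iInf_lt_iff.1 hs
    have hq : qPackMeasure T f (s + (d - c)) ε Z = 0 :=
      le_antisymm (hs₀ ▸ qPackMeasure_add_le T f hδ hε.1.le hε.2 s Z) zero_le
    refine (iInf₂_le (s + (d - c)) hq).trans_lt (lt_trans ?_ hdb)
    exact EReal.coe_lt_coe_iff.2 (by linarith [EReal.coe_lt_coe_iff.1 hsc])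
end
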